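/- (Lemma 2) Let n ≥ 1, let q be the largest prime dividing g(n), and let α, β be real numbers with 0 < α < β < 1. Suppose some prime q' with α·q < q' < β·q divides g(n). Then for any two distinct primes p, p' with √β·q < p < (1+α)·q/2 and √β·q < p' < (1+α)·q/2, at least one of p and p' divides g(n); in other words, at most one prime in the interval (√β·q, (1+α)·q/2) fails to divide g(n). -/

import Mathlib

/-- `g n` is the maximal order of an element of the symmetric group on `n` letters. -/
noncomputable def g (n : ℕ) : ℕ :=
  Finset.univ.sup (fun σ : Equiv.Perm (Fin n) => orderOf σ)

/-- The sum of the prime powers exactly dividing `m`: for `m ≠ 0`, the least number of letters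
on which some permutation has order `m`. -/
def primePowerSum (m : ℕ) : ℕ :=
  m.factorization.sum fun p k => p ^ k

lemma primePowerSum_one : primePowerSum 1 = 0 := by
  simp [primePowerSum]

lemma primePowerSum_prime_pow {p k : ℕ} (hp : p.Prime) (hk : 0 < k) :
    primePowerSum (p ^ k) = p ^ k := by
  simp [primePowerSum, hp.factorization_pow, Finsupp.sum, Finsupp.support_single, hk.ne']

lemma primePowerSum_mul {a b : ℕ} (h : a.Coprime b) :
    primePowerSum (a * b) = primePowerSum a + primePowerSum b := by
  rw [primePowerSum, Nat.factorization_mul_of_coprime h,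
    Finsupp.sum_add_index_of_disjoint h.disjoint_primeFactors]
  rfl

lemma primePowerSum_le_self {m : ℕ} (hm : m ≠ 0) : primePowerSum m ≤ m := by
  induction m using Nat.recOnPosPrimePosCoprime with
  | zero => exact absurd rfl hm
  | one => simp [primePowerSum_one]
  | prime_pow p k hp hk => exact (primePowerSum_prime_pow hp hk).le
  | coprime a b ha hb h iha ihb =>
    rw [primePowerSum_mul h]
    have := iha (by lia)
    have := ihb (by lia)
    nlinarith

lemma primePowerSum_lcm_le {a b : ℕ} (ha : a ≠ 0) (hb : b ≠ 0) :
    primePowerSum (a.lcm b) ≤ primePowerSum a + primePowerSum b := by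
  simp only [primePowerSum, Finsupp.sum, Nat.factorization_lcm ha hb, Finsupp.support_sup,
    Nat.support_factorization]
  calc ∑ p ∈ a.primeFactors ∪ b.primeFactors, p ^ (a.factorization ⊔ b.factorization) p
      ≤ ∑ p ∈ a.primeFactors ∪ b.primeFactors,
          ((if p ∈ a.primeFactors then p ^ a.factorization p else 0) +
            if p ∈ b.primeFactors then p ^ b.factorization p else 0) := by
        refine Finset.sum_le_sum fun p hp => ?_
        have h0 : ∀ m : ℕ, p ∉ m.primeFactors → m.factorization p = 0 := fun m h => by
          rwa [← Nat.support_factorization, Finsupp.notMem_support_iff] at h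
        rw [Finsupp.sup_apply]
        by_cases h1 : p ∈ a.primeFactors <;> by_cases h2 : p ∈ b.primeFactors
        · rw [if_pos h1, if_pos h2]
          rcases max_choice (a.factorization p) (b.factorization p) with h | h <;> simp [h]
        · simp [h1, h2, h0 b h2]
        · simp [h1, h2, h0 a h1]
        · simp_all
    _ = _ := by
        rw [Finset.sum_add_distrib, Finset.sum_ite_mem, Finset.sum_ite_mem,
          Finset.inter_eq_right.2 Finset.subset_union_left,
          Finset.inter_eq_right.2 Finset.subset_union_right]

lemma primePowerSum_multiset_lcm_le (s : Multiset ℕ) (hs : ∀ a ∈ s, a ≠ 0) :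
    primePowerSum s.lcm ≤ s.sum := by
  induction s using Multiset.induction with
  | empty => simp [primePowerSum_one]
  | cons a s ih =>
    rw [Multiset.lcm_cons, Multiset.sum_cons]
    have ha : a ≠ 0 := hs a (Multiset.mem_cons_self a s)
    have hs' : ∀ b ∈ s, b ≠ 0 := fun b hb => hs b (Multiset.mem_cons_of_mem hb)
    have hlcm : s.lcm ≠ 0 := fun h => hs' 0 (Multiset.lcm_eq_zero_iff _ |>.1 h) rfl
    exact (primePowerSum_lcm_le ha hlcm).trans
      (add_le_add (primePowerSum_le_self ha) (ih hs'))

lemma primePowerSum_orderOf_le {n : ℕ} (σ : Equiv.Perm (Fin n)) :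
    primePowerSum (orderOf σ) ≤ n := by
  rw [← Equiv.Perm.lcm_cycleType]
  refine (primePowerSum_multiset_lcm_le _ fun a ha => ?_).trans ?_
  · have := Equiv.Perm.two_le_of_mem_cycleType ha
    lia
  · rw [Equiv.Perm.sum_cycleType]
    simpa using Finset.card_le_univ σ.support

lemma exists_orderOf_eq_of_primePowerSum_le {n m : ℕ} (hm : m ≠ 0) (h : primePowerSum m ≤ n) :
    ∃ σ : Equiv.Perm (Fin n), orderOf σ = m := by
  obtain ⟨σ, hσ⟩ := (Equiv.Perm.exists_with_cycleType_iff (α := Fin n)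
    (m := m.primeFactors.val.map fun p => p ^ m.factorization p)).2 ⟨by
      rw [Fintype.card_fin]; exact h, by
      intro a ha
      obtain ⟨p, hp, rfl⟩ := Multiset.mem_map.1 ha
      have hp' : p ∈ m.primeFactors := hp
      have hpp := Nat.prime_of_mem_primeFactors hp'
      have h1 := hpp.factorization_pos_of_dvd hm (Nat.dvd_of_mem_primeFactors hp')
      exact hpp.two_le.trans (Nat.le_self_pow h1.ne' p)⟩
  refine ⟨σ, ?_⟩
  rw [← Equiv.Perm.lcm_cycleType, hσ]
  change m.primeFactors.lcm (fun p => p ^ m.factorization p) = m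
  rw [Finset.lcm_eq_prod]
  · exact Nat.prod_factorization_pow_eq_self hm
  · intro p hp r hr hpr
    exact Nat.Coprime.pow _ _ ((Nat.coprime_primes (Nat.prime_of_mem_primeFactors hp)
      (Nat.prime_of_mem_primeFactors hr)).2 hpr)

lemma exists_orderOf_eq_g (n : ℕ) : ∃ σ : Equiv.Perm (Fin n), orderOf σ = g n := by
  obtain ⟨σ, -, hσ⟩ := Finset.exists_mem_eq_sup (Finset.univ : Finset (Equiv.Perm (Fin n)))
    Finset.univ_nonempty (fun σ => orderOf σ)
  exact ⟨σ, hσ.symm⟩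

lemma g_ne_zero (n : ℕ) : g n ≠ 0 := by
  obtain ⟨σ, hσ⟩ := exists_orderOf_eq_g n
  exact hσ ▸ (orderOf_pos σ).ne'

lemma primePowerSum_g_le (n : ℕ) : primePowerSum (g n) ≤ n := by
  obtain ⟨σ, hσ⟩ := exists_orderOf_eq_g n
  exact hσ ▸ primePowerSum_orderOf_le σ

lemma le_g_of_primePowerSum_le {n m : ℕ} (hm : m ≠ 0) (h : primePowerSum m ≤ n) : m ≤ g n := by
  obtain ⟨σ, rfl⟩ := exists_orderOf_eq_of_primePowerSum_le hm h
  exact Finset.le_sup (f := fun σ : Equiv.Perm (Fin n) => orderOf σ) (Finset.mem_univ σ)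

lemma primePowerSum_prime_mul {p m : ℕ} (hp : p.Prime) (h : ¬ p ∣ m) :
    primePowerSum (p * m) = p + primePowerSum m := by
  rw [primePowerSum_mul ((hp.coprime_iff_not_dvd).2 h)]
  simpa using primePowerSum_prime_pow hp one_pos

lemma add_primePowerSum_le_prime_mul {p m : ℕ} (hp : p.Prime) (hm : m ≠ 0) :
    p + primePowerSum m ≤ primePowerSum (p * m) := by
  obtain ⟨k, r, hr, rfl⟩ := Nat.exists_eq_pow_mul_and_not_dvd hm p hp.ne_one
  have hc (j : ℕ) : (p ^ j).Coprime r := ((hp.coprime_iff_not_dvd).2 hr).pow_left j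
  rcases Nat.eq_zero_or_pos k with rfl | hk
  · rw [pow_zero, one_mul, primePowerSum_prime_mul hp hr]
  · rw [← mul_assoc, ← pow_succ', primePowerSum_mul (hc _), primePowerSum_mul (hc _),
      primePowerSum_prime_pow hp hk, primePowerSum_prime_pow hp k.succ_pos, pow_succ]
    have h1 := Nat.le_self_pow hk.ne' p
    have h2 := Nat.mul_le_mul_left (p ^ k) hp.two_le
    lia

theorem lemma_two (n : ℕ) (hn : 1 ≤ n) (q : ℕ)
    (hq : q.Prime) (hqdvd : q ∣ g n)
    (hqmax : ∀ r : ℕ, r.Prime → r ∣ g n → r ≤ q)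
    (α β : ℝ) (hα : 0 < α) (hαβ : α < β) (hβ : β < 1)
    (q' : ℕ) (hq' : q'.Prime) (hq'lb : α * q < q') (hq'ub : (q' : ℝ) < β * q)
    (hq'dvd : q' ∣ g n)
    (p p' : ℕ) (hp : p.Prime) (hp' : p'.Prime) (hpp' : p ≠ p')
    (hplb : Real.sqrt β * q < p) (hpub : (p : ℝ) < (1 + α) * q / 2)
    (hp'lb : Real.sqrt β * q < p') (hp'ub : (p' : ℝ) < (1 + α) * q / 2) :
    p ∣ g n ∨ p' ∣ g n := by
  by_contra! ⟨hpg, hp'g⟩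
  have hq0 : (0 : ℝ) < q := by exact_mod_cast hq.pos
  have hne : q ≠ q' := by
    rintro rfl
    nlinarith
  have hsum : p + p' ≤ q + q' := by
    have : (p + p' : ℝ) ≤ q + q' := by linarith
    exact_mod_cast this
  have hprod : q * q' < p * p' := by
    have h1 : (√β * q) * (√β * q) < (p : ℝ) * p' :=
      mul_lt_mul'' hplb hp'lb (by positivity) (by positivity)
    have h2 : (√β * q) * (√β * q) = q * (β * q) := by
      rw [mul_mul_mul_comm, Real.mul_self_sqrt (hα.trans hαβ).le]
      ring
    have h3 := mul_lt_mul_of_pos_left hq'ub hq0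
    have : (q * q' : ℝ) < p * p' := by linarith
    exact_mod_cast this
  obtain ⟨m, hm⟩ : q * q' ∣ g n :=
    ((Nat.coprime_primes hq hq').2 hne).mul_dvd_of_dvd_of_dvd hqdvd hq'dvd
  have hm0 : m ≠ 0 := by
    rintro rfl
    exact g_ne_zero n (by simpa using hm)
  have hmg : m ∣ g n := ⟨q * q', by rw [hm, mul_comm]⟩
  have hp'm : ¬ p' ∣ m := fun h => hp'g (h.trans hmg)
  have hpm : ¬ p ∣ p' * m := fun h => (hp.dvd_mul.1 h).elim
    (fun h => hpp' ((Nat.prime_dvd_prime_iff_eq hp hp').1 h)) fun h => hpg (h.trans hmg)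
  have hnew : primePowerSum (p * (p' * m)) = p + (p' + primePowerSum m) := by
    rw [primePowerSum_prime_mul hp hpm, primePowerSum_prime_mul hp' hp'm]
  have hold : q + (q' + primePowerSum m) ≤ n :=
    calc q + (q' + primePowerSum m) ≤ q + primePowerSum (q' * m) :=
          Nat.add_le_add_left (add_primePowerSum_le_prime_mul hq' hm0) q
      _ ≤ primePowerSum (q * (q' * m)) :=
          add_primePowerSum_le_prime_mul hq (mul_ne_zero hq'.ne_zero hm0)
      _ ≤ n := by rw [← mul_assoc, ← hm]; exact primePowerSum_g_le n
  have hle : p * (p' * m) ≤ g n :=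
    le_g_of_primePowerSum_le (mul_ne_zero hp.ne_zero (mul_ne_zero hp'.ne_zero hm0)) (by lia)
  rw [hm, ← mul_assoc] at hle
  exact absurd hle (Nat.mul_lt_mul_of_pos_right hprod (Nat.pos_of_ne_zero hm0)).not_ge
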